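/- Assume K ≥ 2. Then the descent set of the atomic norm ‖·‖_{Σ_K} on Σ_K is all of E: for every z ∈ E there exists x ∈ Σ_K with ‖x+z‖_{Σ_K} ≤ ‖x‖_{Σ_K}, and conversely every z ∈ H with ‖x+z‖_{Σ_K} ≤ ‖x‖_{Σ_K} for some x ∈ Σ_K belongs to E. Consequently, for every real normed space F and every linear map M : H → F whose kernel contains a nonzero element of E, there exist x₀ ∈ Σ_K and x₁ ∈ H with x₁ ≠ x₀, M x₁ = M x₀ and ‖x₁‖_{Σ_K} ≤ ‖x₀‖_{Σ_K}; in particular, x₀ is not the unique minimizer of ‖·‖_{Σ_K} over {x ∈ H : Mx = Mx₀}, so uniform recovery of Σ_K by minimizing ‖·‖_{Σ_K} is impossible. -/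

import Mathlib

open scoped RealInnerProductSpace Pointwise ENNReal
open Metric

variable {H : Type*} [NormedAddCommGroup H] [InnerProductSpace ℝ H]

noncomputable def atomicNorm (A : Set H) (x : H) : ℝ≥0∞ :=
  ⨅ t : {t : ℝ // 0 ≤ t ∧ x ∈ t • closure (convexHull ℝ A)}, ENNReal.ofReal (t : ℝ)

noncomputable def coneNorm (S : Set H) (x : H) : ℝ≥0∞ :=
  atomicNorm (S ∩ sphere (0 : H) 1) x

noncomputable def gproj (e : ℕ → H) (g : Finset ℕ) (x : H) : H :=
  ∑ i ∈ g, ⟪x, e i⟫ • e i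

noncomputable def gprojS (e : ℕ → H) (Hs : Finset (Finset ℕ)) (x : H) : H :=
  ∑ g ∈ Hs, gproj e g x

def Egrp (e : ℕ → H) (G : Finset (Finset ℕ)) : Set H :=
  (Submodule.span ℝ (e '' (G.biUnion id : Finset ℕ)) : Set H)

def SigmaK (e : ℕ → H) (G : Finset (Finset ℕ)) (K : ℕ) : Set H :=
  {x : H | ∃ H' ⊆ G, H'.card ≤ K ∧ x = gprojS e H' x}

noncomputable def groupNormR (e : ℕ → H) (G : Finset (Finset ℕ)) (x : H) : ℝ :=
  ∑ g ∈ G, ‖gproj e g x‖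

open Classical in
noncomputable def groupNorm (e : ℕ → H) (G : Finset (Finset ℕ)) (x : H) : ℝ≥0∞ :=
  if x ∈ Egrp e G then ENNReal.ofReal (groupNormR e G x) else ⊤

noncomputable def dualNorm (e : ℕ → H) (G : Finset (Finset ℕ)) (x : H) : ℝ :=
  sSup ((fun g => ‖gproj e g x‖) '' (G : Set (Finset ℕ)))

theorem gproj_add (e : ℕ → H) (g : Finset ℕ) (x y : H) :
    gproj e g (x + y) = gproj e g x + gproj e g y := by
  simp [gproj, inner_add_left, add_smul, Finset.sum_add_distrib]

theorem gproj_smul (e : ℕ → H) (g : Finset ℕ) (c : ℝ) (x : H) :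
    gproj e g (c • x) = c • gproj e g x := by
  simp [gproj, real_inner_smul_left, mul_smul, Finset.smul_sum]

theorem gproj_zero (e : ℕ → H) (g : Finset ℕ) : gproj e g (0 : H) = 0 := by
  simp [gproj]

theorem gproj_basis_mem {e : ℕ → H} (he : Orthonormal ℝ e) {g : Finset ℕ} {i : ℕ} (hi : i ∈ g) :
    gproj e g (e i) = e i := by
  simp [gproj, orthonormal_iff_ite.mp he, hi]

theorem gproj_basis_notMem {e : ℕ → H} (he : Orthonormal ℝ e) {g : Finset ℕ} {i : ℕ}
    (hi : i ∉ g) : gproj e g (e i) = 0 := by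
  simp [gproj, orthonormal_iff_ite.mp he, hi]

theorem inner_gproj_basis {e : ℕ → H} (he : Orthonormal ℝ e) (g : Finset ℕ) (x : H) (j : ℕ) :
    ⟪gproj e g x, e j⟫ = if j ∈ g then ⟪x, e j⟫ else 0 := by
  simp [gproj, sum_inner, real_inner_smul_left, orthonormal_iff_ite.mp he]

theorem gproj_gproj_self {e : ℕ → H} (he : Orthonormal ℝ e) (g : Finset ℕ) (x : H) :
    gproj e g (gproj e g x) = gproj e g x := by
  rw [gproj]
  refine Finset.sum_congr rfl fun i hi => ?_
  rw [inner_gproj_basis he, if_pos hi]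

theorem gproj_gproj_of_disjoint {e : ℕ → H} (he : Orthonormal ℝ e) {g g' : Finset ℕ}
    (h : Disjoint g g') (x : H) : gproj e g (gproj e g' x) = 0 := by
  rw [gproj]
  refine Finset.sum_eq_zero fun i hi => ?_
  rw [inner_gproj_basis he, if_neg (Finset.disjoint_left.mp h hi), zero_smul]

theorem inner_gproj_gproj_of_disjoint {e : ℕ → H} (he : Orthonormal ℝ e) {g g' : Finset ℕ}
    (h : Disjoint g g') (x y : H) : ⟪gproj e g x, gproj e g' y⟫ = 0 := by
  conv_lhs => rw [gproj.eq_def e g' y]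
  rw [inner_sum]
  refine Finset.sum_eq_zero fun i hi => ?_
  rw [real_inner_smul_right, inner_gproj_basis he, if_neg (Finset.disjoint_right.mp h hi), mul_zero]

theorem gprojS_eq_of_mem_Egrp {e : ℕ → H} (he : Orthonormal ℝ e) {G : Finset (Finset ℕ)}
    (hGdisj : (G : Set (Finset ℕ)).Pairwise fun g g' => Disjoint g g') {z : H}
    (hz : z ∈ Egrp e G) : gprojS e G z = z := by
  refine Submodule.span_induction (p := fun z _ => gprojS e G z = z) ?_ ?_ ?_ ?_ hz
  · rintro _ ⟨i, hi, rfl⟩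
    obtain ⟨g, hg, hig⟩ : ∃ g ∈ G, i ∈ g := by simpa using hi
    rw [gprojS, Finset.sum_eq_single_of_mem g hg, gproj_basis_mem he hig]
    intro g' hg' hne
    exact gproj_basis_notMem he (Finset.disjoint_right.mp (hGdisj hg' hg hne) hig)
  · simp [gprojS, gproj_zero]
  · intro x y _ _ hx hy
    simp only [gprojS, gproj_add, Finset.sum_add_distrib] at *
    rw [hx, hy]
  · intro c x _ hx
    simp only [gprojS, gproj_smul, ← Finset.smul_sum] at *
    rw [hx]

theorem gproj_mem_Egrp (e : ℕ → H) {G : Finset (Finset ℕ)} {g : Finset ℕ} (hg : g ∈ G) (x : H) :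
    gproj e g x ∈ Egrp e G := by
  refine Submodule.sum_mem _ fun i hi => Submodule.smul_mem _ _ (Submodule.subset_span ?_)
  exact ⟨i, by simpa using ⟨g, hg, hi⟩, rfl⟩

theorem SigmaK_subset_Egrp (e : ℕ → H) (G : Finset (Finset ℕ)) (K : ℕ) :
    SigmaK e G K ⊆ Egrp e G := by
  rintro x ⟨H', hH', -, hx⟩
  rw [hx]
  exact Submodule.sum_mem _ fun g hg => gproj_mem_Egrp e (hH' hg) x

theorem smul_mem_SigmaK {e : ℕ → H} {G : Finset (Finset ℕ)} {K : ℕ} {x : H}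
    (hx : x ∈ SigmaK e G K) (c : ℝ) : c • x ∈ SigmaK e G K := by
  obtain ⟨H', hH', hK, hx⟩ := hx
  refine ⟨H', hH', hK, ?_⟩
  simp only [gprojS, gproj_smul, ← Finset.smul_sum] at *
  rw [← hx]

theorem gproj_mem_SigmaK {e : ℕ → H} (he : Orthonormal ℝ e) {G : Finset (Finset ℕ)} {K : ℕ}
    (hK : 1 ≤ K) {g : Finset ℕ} (hg : g ∈ G) (x : H) : gproj e g x ∈ SigmaK e G K :=
  ⟨{g}, by simpa using hg, by simpa using hK, by simp [gprojS, gproj_gproj_self he]⟩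

theorem gproj_add_gproj_mem_SigmaK {e : ℕ → H} (he : Orthonormal ℝ e) {G : Finset (Finset ℕ)}
    {K : ℕ} (hK : 2 ≤ K) {g g' : Finset ℕ} (hg : g ∈ G) (hg' : g' ∈ G) (hne : g ≠ g')
    (h : Disjoint g g') (x y : H) : gproj e g x + gproj e g' y ∈ SigmaK e G K := by
  refine ⟨{g, g'}, ?_, Finset.card_le_two.trans hK, ?_⟩
  · simp [Finset.insert_subset_iff, hg, hg']
  · simp [gprojS, Finset.sum_pair hne, gproj_add, gproj_gproj_self he,
      gproj_gproj_of_disjoint he h, gproj_gproj_of_disjoint he h.symm]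

theorem atoms_nonempty {e : ℕ → H} (he : Orthonormal ℝ e) {G : Finset (Finset ℕ)}
    (hGnon : G.Nonempty) (hGne : ∀ g ∈ G, g.Nonempty) {K : ℕ} (hK : 1 ≤ K) :
    (SigmaK e G K ∩ sphere (0 : H) 1).Nonempty := by
  obtain ⟨g, hg⟩ := hGnon
  obtain ⟨i, hi⟩ := hGne g hg
  refine ⟨e i, ?_, by simpa using he.1 i⟩
  rw [← gproj_basis_mem he hi]
  exact gproj_mem_SigmaK he hK hg _

theorem mem_norm_smul_closure_convexHull {S : Set H} (hS : ∀ x ∈ S, ∀ c : ℝ, c • x ∈ S)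
    (hne : (S ∩ sphere (0 : H) 1).Nonempty) {u : H} (hu : u ∈ S) :
    u ∈ ‖u‖ • closure (convexHull ℝ (S ∩ sphere (0 : H) 1)) := by
  by_cases h0 : u = 0
  · subst h0
    rw [norm_zero, Set.zero_smul_set (hne.convexHull.closure)]
    exact Set.mem_zero.mpr rfl
  · have hn : ‖u‖ ≠ 0 := norm_ne_zero_iff.mpr h0
    refine ⟨‖u‖⁻¹ • u, subset_closure (subset_convexHull ℝ _ ⟨hS u hu _, ?_⟩), ?_⟩
    · simp [norm_smul, hn]
    · simp [smul_smul, hn]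

theorem sum_mem_sum_smul {ι V : Type*} [AddCommGroup V] [Module ℝ V] {C : Set V}
    (hC : Convex ℝ C) (hne : C.Nonempty) (s : Finset ι) (u : ι → V) (c : ι → ℝ)
    (hc : ∀ i ∈ s, 0 ≤ c i) (hu : ∀ i ∈ s, u i ∈ c i • C) :
    ∑ i ∈ s, u i ∈ (∑ i ∈ s, c i) • C := by
  classical
  induction s using Finset.induction_on with
  | empty => simp [Set.zero_smul_set hne]
  | insert a s ha ih =>
    rw [Finset.sum_insert ha, Finset.sum_insert ha, hC.add_smul (hc a (by simp))
      (Finset.sum_nonneg fun i hi => hc i (by simp [hi]))]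
    exact Set.add_mem_add (hu a (by simp))
      (ih (fun i hi => hc i (by simp [hi])) (fun i hi => hu i (by simp [hi])))

theorem coneNorm_sum_le {ι : Type*} {S : Set H} (hS : ∀ x ∈ S, ∀ c : ℝ, c • x ∈ S)
    (hne : (S ∩ sphere (0 : H) 1).Nonempty) (s : Finset ι) (u : ι → H) (hu : ∀ i ∈ s, u i ∈ S) :
    coneNorm S (∑ i ∈ s, u i) ≤ ENNReal.ofReal (∑ i ∈ s, ‖u i‖) :=
  iInf_le_of_le ⟨∑ i ∈ s, ‖u i‖, Finset.sum_nonneg fun _ _ => norm_nonneg _,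
    sum_mem_sum_smul (convex_convexHull ℝ _).closure hne.convexHull.closure s u _
      (fun _ _ => norm_nonneg _)
      (fun i hi => mem_norm_smul_closure_convexHull hS hne (hu i hi))⟩ le_rfl

theorem coneNorm_le_norm {S : Set H} (hS : ∀ x ∈ S, ∀ c : ℝ, c • x ∈ S)
    (hne : (S ∩ sphere (0 : H) 1).Nonempty) {u : H} (hu : u ∈ S) :
    coneNorm S u ≤ ENNReal.ofReal ‖u‖ := by
  simpa using coneNorm_sum_le hS hne {()} (fun _ => u) (by simpa using hu)

theorem norm_le_coneNorm (S : Set H) (x : H) : ENNReal.ofReal ‖x‖ ≤ coneNorm S x := by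
  refine le_iInf ?_
  rintro ⟨t, ht, y, hy, rfl⟩
  refine ENNReal.ofReal_le_ofReal ?_
  have hsub : closure (convexHull ℝ (S ∩ sphere (0 : H) 1)) ⊆ closedBall 0 1 :=
    closure_minimal (convexHull_min (Set.inter_subset_right.trans sphere_subset_closedBall)
      (convex_closedBall _ _)) isClosed_closedBall
  have hy1 : ‖y‖ ≤ 1 := by simpa using hsub hy
  simpa [norm_smul, abs_of_nonneg ht] using mul_le_of_le_one_right ht hy1

theorem mem_Egrp_of_coneNorm_ne_top {e : ℕ → H} {G : Finset (Finset ℕ)} {K : ℕ} {x : H}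
    (hx : coneNorm (SigmaK e G K) x ≠ ⊤) : x ∈ Egrp e G := by
  by_contra hxE
  refine hx (iInf_eq_top.mpr ?_)
  rintro ⟨t, ht, y, hy, rfl⟩
  have hfin : FiniteDimensional ℝ (Submodule.span ℝ (e '' (G.biUnion id : Finset ℕ))) :=
    FiniteDimensional.span_of_finite ℝ ((Finset.finite_toSet _).image e)
  have hsub : closure (convexHull ℝ (SigmaK e G K ∩ sphere (0 : H) 1)) ⊆ Egrp e G :=
    closure_minimal (convexHull_min (Set.inter_subset_left.trans (SigmaK_subset_Egrp e G K))
      (Submodule.convex _)) (Submodule.closed_of_finiteDimensional _)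
  exact absurd (Submodule.smul_mem _ t (hsub hy)) hxE

theorem exists_coneNorm_add_le {e : ℕ → H} (he : Orthonormal ℝ e) {G : Finset (Finset ℕ)}
    (hGnon : G.Nonempty) (hGne : ∀ g ∈ G, g.Nonempty)
    (hGdisj : (G : Set (Finset ℕ)).Pairwise fun g g' => Disjoint g g')
    {K : ℕ} (hK : 2 ≤ K) {z : H} (hz : z ∈ Egrp e G) :
    ∃ x ∈ SigmaK e G K, coneNorm (SigmaK e G K) (x + z) ≤ coneNorm (SigmaK e G K) x := by
  classical
  have hzsum := gprojS_eq_of_mem_Egrp he hGdisj hz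
  by_cases hz0 : z = 0
  · exact ⟨0, ⟨∅, by simp, by simp, by simp [gprojS]⟩, by simp [hz0]⟩
  obtain ⟨g, hg, hgz⟩ : ∃ g ∈ G, gproj e g z ≠ 0 := by
    by_contra! h
    exact hz0 (by rw [← hzsum]; exact Finset.sum_eq_zero h)
  set a := ‖gproj e g z‖ with ha
  have ha0 : 0 < a := norm_pos_iff.mpr hgz
  set m : ℝ := ((G.erase g).card : ℝ) with hm
  set B := ∑ g' ∈ G, ‖gproj e g' z‖ ^ 2 with hB
  have hB0 : 0 ≤ B := Finset.sum_nonneg fun _ _ => sq_nonneg _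
  set s : ℝ := m * B / a ^ 2 with hs
  have hs0 : 0 ≤ s := by positivity
  have hm0 : 0 ≤ m := by positivity
  refine ⟨(-(1 + m * s)) • gproj e g z,
    smul_mem_SigmaK (gproj_mem_SigmaK he (by omega) hg z) _, ?_⟩
  have hdecomp : (-(1 + m * s)) • gproj e g z + z =
      ∑ g' ∈ G.erase g, (gproj e g ((-s) • z) + gproj e g' z) := by
    have hsplit : z = gproj e g z + ∑ g' ∈ G.erase g, gproj e g' z :=
      hzsum.symm.trans (Finset.add_sum_erase _ _ hg).symm
    rw [Finset.sum_add_distrib, Finset.sum_const, gproj_smul, ← Nat.cast_smul_eq_nsmul ℝ, ← hm,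
      ← sub_eq_of_eq_add' hsplit]
    module
  have hterm : ∀ g' ∈ G.erase g, ‖gproj e g ((-s) • z) + gproj e g' z‖ ≤ s * a + a / m := by
    intro g' hg'
    have hmpos : 0 < m := by
      rw [hm]; exact_mod_cast Finset.card_pos.mpr ⟨g', hg'⟩
    obtain ⟨hne, hg'G⟩ := Finset.mem_erase.mp hg'
    have hb : ‖gproj e g' z‖ ^ 2 ≤ B :=
      Finset.single_le_sum (f := fun g' => ‖gproj e g' z‖ ^ 2) (fun _ _ => sq_nonneg _) hg'G
    have hpyth : ‖gproj e g ((-s) • z) + gproj e g' z‖ ^ 2 = (s * a) ^ 2 + ‖gproj e g' z‖ ^ 2 := by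
      rw [norm_add_sq_real, inner_gproj_gproj_of_disjoint he (hGdisj hg hg'G hne.symm),
        gproj_smul, norm_smul, norm_neg, Real.norm_of_nonneg hs0]
      ring
    have hcross : s * a * (a / m) = B := by
      rw [hs]; field_simp
    refine le_of_sq_le_sq ?_ (by positivity)
    rw [hpyth]
    nlinarith [sq_nonneg (a / m)]
  have hsum : ∑ g' ∈ G.erase g, ‖gproj e g ((-s) • z) + gproj e g' z‖ ≤ (1 + m * s) * a := by
    refine (Finset.sum_le_sum hterm).trans ?_
    rw [Finset.sum_const, nsmul_eq_mul, ← hm]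
    rcases hm0.eq_or_lt with h | h
    · rw [← h]; simpa using ha0.le
    · refine le_of_eq ?_
      field_simp
      ring
  calc coneNorm (SigmaK e G K) ((-(1 + m * s)) • gproj e g z + z)
      ≤ ENNReal.ofReal (∑ g' ∈ G.erase g, ‖gproj e g ((-s) • z) + gproj e g' z‖) := by
        rw [hdecomp]
        refine coneNorm_sum_le (fun x hx c => smul_mem_SigmaK hx c)
          (atoms_nonempty he hGnon hGne (by omega)) _ _ fun g' hg' => ?_
        obtain ⟨hne, hg'G⟩ := Finset.mem_erase.mp hg'
        exact gproj_add_gproj_mem_SigmaK he hK hg hg'G hne.symm (hGdisj hg hg'G hne.symm) _ _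
    _ ≤ ENNReal.ofReal ‖(-(1 + m * s)) • gproj e g z‖ := by
        refine ENNReal.ofReal_le_ofReal (hsum.trans_eq ?_)
        rw [norm_smul, norm_neg, Real.norm_of_nonneg (by positivity)]
    _ ≤ _ := norm_le_coneNorm _ _

theorem stmt19 [CompleteSpace H]
    (e : ℕ → H) (he : Orthonormal ℝ e)
    (htot : (Submodule.span ℝ (Set.range e)).topologicalClosure = ⊤)
    (G : Finset (Finset ℕ)) (hGnon : G.Nonempty) (hGne : ∀ g ∈ G, g.Nonempty)
    (hGdisj : (G : Set (Finset ℕ)).Pairwise fun g g' => Disjoint g g')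
    (K : ℕ) (hK : 2 ≤ K) :
    (∀ z ∈ Egrp e G, ∃ x ∈ SigmaK e G K,
        coneNorm (SigmaK e G K) (x + z) ≤ coneNorm (SigmaK e G K) x) ∧
    (∀ z : H, (∃ x ∈ SigmaK e G K,
        coneNorm (SigmaK e G K) (x + z) ≤ coneNorm (SigmaK e G K) x) → z ∈ Egrp e G) ∧
    (∀ (F : Type*) [NormedAddCommGroup F] [NormedSpace ℝ F] (M : H →ₗ[ℝ] F),
      (∃ z ∈ Egrp e G, z ≠ 0 ∧ M z = 0) →
      ∃ x₀ ∈ SigmaK e G K, ∃ x₁ : H, x₁ ≠ x₀ ∧ M x₁ = M x₀ ∧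
        coneNorm (SigmaK e G K) x₁ ≤ coneNorm (SigmaK e G K) x₀) := by
  refine ⟨fun z hz => exists_coneNorm_add_le he hGnon hGne hGdisj hK hz, ?_, ?_⟩
  · rintro z ⟨x, hx, hle⟩
    have hfin : coneNorm (SigmaK e G K) (x + z) ≠ ⊤ :=
      ne_top_of_le_ne_top ENNReal.ofReal_ne_top (hle.trans
        (coneNorm_le_norm (fun x hx c => smul_mem_SigmaK hx c)
          (atoms_nonempty he hGnon hGne (by omega)) hx))
    exact (Submodule.add_mem_iff_right _ (SigmaK_subset_Egrp e G K hx)).mp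
      (mem_Egrp_of_coneNorm_ne_top hfin)
  · rintro F _ _ M ⟨z, hz, hz0, hMz⟩
    obtain ⟨x, hx, hle⟩ := exists_coneNorm_add_le he hGnon hGne hGdisj hK hz
    exact ⟨x, hx, x + z, by simpa using hz0, by simp [hMz], hle⟩
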